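/- Let κ be a regular uncountable cardinal. The null ideal N on the Cantor space 2^ω is (κ,λ)-nicely generated for some cardinal λ with κ ≤ λ ≤ 2^{ℵ₀} if and only if add(N) = cof(N) = κ. -/

import Mathlib

open Cardinal Set MeasureTheory

/-- An ideal `I` on a set `X` is `(κ, λ)`-nicely generated if there is a partition
`⟨X_α : α < λ⟩` of `X` into nonempty sets belonging to `I` such that (i) the union of any
fewer than `κ` pieces belongs to `I`, and (ii) every member of `I` is contained in the
union of fewer than `κ` pieces. -/
def NicelyGenerated {X : Type u} (I : Set (Set X)) (κ lam : Cardinal.{u}) : Prop :=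
  ∃ (ι : Type u) (Xs : ι → Set X),
    #ι = lam ∧
    (∀ i, Xs i ∈ I) ∧
    (∀ i, (Xs i).Nonempty) ∧
    (∀ i j, i ≠ j → Disjoint (Xs i) (Xs j)) ∧
    (⋃ i, Xs i) = Set.univ ∧
    (∀ Δ : Set ι, #Δ < κ → (⋃ i ∈ Δ, Xs i) ∈ I) ∧
    (∀ Y ∈ I, ∃ Δ : Set ι, #Δ < κ ∧ Y ⊆ ⋃ i ∈ Δ, Xs i)

/-- The additivity of an ideal `I`: the least cardinality of a subfamily of `I` whose
union is not in `I`. -/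
noncomputable def addIdeal {X : Type u} (I : Set (Set X)) : Cardinal.{u} :=
  sInf {c | ∃ F : Set (Set X), F ⊆ I ∧ ⋃₀ F ∉ I ∧ #F = c}

/-- The cofinality of an ideal `I`: the least cardinality of a subfamily of `I` that is
cofinal in `I` with respect to inclusion. -/
noncomputable def cofIdeal {X : Type u} (I : Set (Set X)) : Cardinal.{u} :=
  sInf {c | ∃ F : Set (Set X), F ⊆ I ∧ (∀ Y ∈ I, ∃ Z ∈ F, Y ⊆ Z) ∧ #F = c}

/-- `μ` is the uniform product measure on the Cantor space `2^ω = ℕ → 2`: each basic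
cylinder determined by the first `n` coordinates has measure `(1/2)^n`. (This property
determines `μ` uniquely on the Borel = product σ-algebra.) -/
def IsCantorMeasure (μ : Measure (ℕ → Bool)) : Prop :=
  ∀ (n : ℕ) (s : ℕ → Bool), μ {f | ∀ i < n, f i = s i} = (1 / 2 : ENNReal) ^ n

section Ideal

variable {X ι : Type u} {I : Set (Set X)} {κ : Cardinal.{u}} {Xs : ι → Set X}

theorem mk_Iio_ord_lt (a : κ.ord.ToType) : #(Iio a) < κ := by
  simpa using mk_Iio_lt a (by simp)

/-- If fewer than `κ` pieces always have union in `I`, and every member of `I` is covered by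
fewer than `κ` pieces, then `I` is closed under unions of fewer than `κ` members. -/
theorem biUnion_mem_of_pieces (hI : ∀ A ∈ I, ∀ B ⊆ A, B ∈ I) (hreg : κ.IsRegular)
    (hsmall : ∀ Δ : Set ι, #Δ < κ → (⋃ i ∈ Δ, Xs i) ∈ I)
    (hcover : ∀ Y ∈ I, ∃ Δ : Set ι, #Δ < κ ∧ Y ⊆ ⋃ i ∈ Δ, Xs i)
    {β : Type u} (S : Set β) (A : β → Set X) (hS : #S < κ) (hA : ∀ b ∈ S, A b ∈ I) :
    (⋃ b ∈ S, A b) ∈ I := by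
  choose! Δ hΔ hsub using fun b (hb : b ∈ S) => hcover (A b) (hA b hb)
  refine hI _ (hsmall (⋃ b ∈ S, Δ b)
    ((card_biUnion_lt_iff_forall_of_isRegular hreg hS).2 hΔ)) _ ?_
  intro x hx
  simp only [mem_iUnion, exists_prop] at hx ⊢
  obtain ⟨b, hb, hx⟩ := hx
  have := hsub b hb hx
  simp only [mem_iUnion, exists_prop] at this
  obtain ⟨i, hi, hxi⟩ := this
  exact ⟨i, ⟨b, hb, hi⟩, hxi⟩

theorem subset_of_transversal_subset (hdisj : ∀ i j, i ≠ j → Disjoint (Xs i) (Xs j))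
    {p : ι → X} (hp : ∀ i, p i ∈ Xs i) {S Δ : Set ι} (h : p '' S ⊆ ⋃ i ∈ Δ, Xs i) :
    S ⊆ Δ := by
  intro i hi
  have := h (mem_image_of_mem p hi)
  simp only [mem_iUnion, exists_prop] at this
  obtain ⟨j, hj, hij⟩ := this
  by_contra hn
  have hne : i ≠ j := fun e => hn (e ▸ hj)
  exact (Set.disjoint_left.1 (hdisj i j hne)) (hp i) hij

theorem addIdeal_eq_of_pieces (hI : ∀ A ∈ I, ∀ B ⊆ A, B ∈ I) (hreg : κ.IsRegular)
    (hι : κ ≤ #ι) (hmem : ∀ i, Xs i ∈ I) (hne : ∀ i, (Xs i).Nonempty)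
    (hdisj : ∀ i j, i ≠ j → Disjoint (Xs i) (Xs j))
    (hsmall : ∀ Δ : Set ι, #Δ < κ → (⋃ i ∈ Δ, Xs i) ∈ I)
    (hcover : ∀ Y ∈ I, ∃ Δ : Set ι, #Δ < κ ∧ Y ⊆ ⋃ i ∈ Δ, Xs i) :
    addIdeal I = κ := by
  obtain ⟨S, hS⟩ := le_mk_iff_exists_set.1 hι
  choose p hp using hne
  have hF : ⋃₀ (Xs '' S) ∉ I := by
    intro h
    obtain ⟨Δ, hΔ, hsub⟩ := hcover _ h
    have : S ⊆ Δ := subset_of_transversal_subset hdisj hp <| by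
      rintro _ ⟨i, hi, rfl⟩
      exact hsub ⟨Xs i, mem_image_of_mem _ hi, hp i⟩
    exact absurd (mk_le_mk_of_subset this) (by rw [hS]; exact not_le.2 hΔ)
  have hFI : Xs '' S ⊆ I := by
    rintro _ ⟨i, -, rfl⟩
    exact hmem i
  refine le_antisymm ?_ (le_csInf ⟨_, _, hFI, hF, rfl⟩ ?_)
  · exact (csInf_le' ⟨Xs '' S, hFI, hF, rfl⟩ : addIdeal I ≤ #(Xs '' S)).trans (mk_image_le.trans hS.le)
  · rintro _ ⟨F, hF, hU, rfl⟩
    by_contra! hlt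
    apply hU
    have := biUnion_mem_of_pieces hI hreg hsmall hcover F id hlt hF
    rwa [sUnion_eq_biUnion]

theorem le_cofIdeal (huniv : Set.univ ∉ I) (hsing : ∀ x, ∃ A ∈ I, x ∈ A) :
    addIdeal I ≤ cofIdeal I := by
  refine le_csInf ⟨_, I, Subset.rfl, fun Y hY => ⟨Y, hY, Subset.rfl⟩, rfl⟩ ?_
  rintro _ ⟨F, hF, hcof, rfl⟩
  have hall : ⋃₀ F = Set.univ := by
    refine eq_univ_of_forall fun x => ?_
    obtain ⟨A, hA, hx⟩ := hsing x
    obtain ⟨Z, hZ, hAZ⟩ := hcof A hA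
    exact ⟨Z, hZ, hAZ hx⟩
  exact csInf_le' ⟨F, hF, hall ▸ huniv, rfl⟩

theorem cofIdeal_le_of_pieces (hreg : κ.IsRegular) (hι : #ι = κ)
    (hsmall : ∀ Δ : Set ι, #Δ < κ → (⋃ i ∈ Δ, Xs i) ∈ I)
    (hcover : ∀ Y ∈ I, ∃ Δ : Set ι, #Δ < κ ∧ Y ⊆ ⋃ i ∈ Δ, Xs i) :
    cofIdeal I ≤ κ := by
  obtain ⟨e⟩ : Nonempty (ι ≃ κ.ord.ToType) := Cardinal.eq.1 (by rw [hι, mk_ord_toType])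
  let g : κ.ord.ToType → Set X := fun a => ⋃ i ∈ e ⁻¹' Iio a, Xs i
  have hle : #(range g) ≤ κ := mk_range_le.trans (mk_ord_toType κ).le
  refine le_trans (b := #(range g)) (csInf_le' ⟨range g, ?_, ?_, rfl⟩) hle
  · rintro _ ⟨a, rfl⟩
    apply hsmall
    rw [mk_preimage_equiv]
    exact mk_Iio_ord_lt a
  · intro Y hY
    obtain ⟨Δ, hΔ, hsub⟩ := hcover Y hY
    have hnc : ¬ IsCofinal (e '' Δ) := fun h => by
      have h1 := Order.cof_le h
      rw [Ordinal.cof_toType, hreg.cof_ord] at h1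
      exact absurd (h1.trans mk_image_le) (not_le.2 hΔ)
    simp only [IsCofinal, not_forall, not_exists, not_and, not_le] at hnc
    obtain ⟨a, ha⟩ := hnc
    refine ⟨g a, ⟨a, rfl⟩, hsub.trans ?_⟩
    exact biUnion_subset_biUnion_left fun i hi => ha _ (mem_image_of_mem e hi)

/-- An ideal whose additivity and cofinality agree is nicely generated: disjointify a
cofinal family enumerated in order type `κ`. -/
theorem exists_nicelyGenerated (hI : ∀ A ∈ I, ∀ B ⊆ A, B ∈ I) (huniv : Set.univ ∉ I)
    (hsing : ∀ x, ∃ A ∈ I, x ∈ A) (hadd : addIdeal I = κ) (hcof : cofIdeal I = κ)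
    (hreg : κ.IsRegular) : κ ≤ #X ∧ NicelyGenerated I κ κ := by
  have hmem : cofIdeal I ∈ {c | ∃ F : Set (Set X), F ⊆ I ∧ (∀ Y ∈ I, ∃ Z ∈ F, Y ⊆ Z) ∧ #F = c} :=
    csInf_mem ⟨_, I, Subset.rfl, fun Y hY => ⟨Y, hY, Subset.rfl⟩, rfl⟩
  rw [hcof] at hmem
  obtain ⟨F, hFI, hF, hcard⟩ := hmem
  have hunion : ∀ G : Set (Set X), G ⊆ I → #G < κ → ⋃₀ G ∈ I := by
    intro G hG hlt
    by_contra hn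
    exact notMem_of_lt_csInf' (hadd.symm ▸ hlt : #G < addIdeal I) ⟨G, hG, hn, rfl⟩
  obtain ⟨e⟩ : Nonempty (κ.ord.ToType ≃ F) := Cardinal.eq.1 (by rw [hcard, mk_ord_toType])
  let A : κ.ord.ToType → Set X := fun a => (e a : Set X) \ ⋃ b ∈ Iio a, (e b : Set X)
  have hA : ∀ a, A a ∈ I := fun a => hI _ (hFI (e a).2) _ sdiff_subset
  have hcov : ∀ a, (e a : Set X) ⊆ ⋃ b ∈ Iic a, A b := by
    intro a x hx
    obtain ⟨b, hb, hmin⟩ :=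
      WellFounded.has_min (wellFounded_lt (α := κ.ord.ToType)) {b | x ∈ (e b : Set X)} ⟨a, hx⟩
    simp only [mem_iUnion, exists_prop]
    refine ⟨b, not_lt.1 (hmin a hx), hb, ?_⟩
    simp only [mem_iUnion, exists_prop, not_exists, not_and]
    exact fun c hc hxc => hmin c hxc hc
  have hdisj : ∀ a b, a < b → Disjoint (A a) (A b) := by
    intro a b hab
    refine Set.disjoint_left.2 fun x hxa hxb => hxb.2 ?_
    exact mem_biUnion (mem_Iio.2 hab) hxa.1
  let ι := {a // (A a).Nonempty}
  let Xs : ι → Set X := fun i => A i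
  have hall : (⋃ i, Xs i) = Set.univ := by
    refine eq_univ_of_forall fun x => ?_
    obtain ⟨Y, hY, hx⟩ := hsing x
    obtain ⟨Z, hZ, hYZ⟩ := hF Y hY
    have hx' : x ∈ (e (e.symm ⟨Z, hZ⟩) : Set X) := by simpa using hYZ hx
    have := hcov _ hx'
    simp only [mem_iUnion, exists_prop] at this
    obtain ⟨b, -, hb⟩ := this
    exact mem_iUnion.2 ⟨⟨b, x, hb⟩, hb⟩
  have hsmall : ∀ Δ : Set ι, #Δ < κ → (⋃ i ∈ Δ, Xs i) ∈ I := by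
    intro Δ hΔ
    rw [← sUnion_image]
    refine hunion _ ?_ (mk_image_le.trans_lt hΔ)
    rintro _ ⟨i, -, rfl⟩
    exact hA i
  have hcard : #ι = κ := by
    refine le_antisymm ((mk_subtype_le _).trans (mk_ord_toType κ).le) ?_
    by_contra! hlt
    apply huniv
    rw [← hall, ← biUnion_univ]
    exact hsmall _ (by rwa [mk_univ])
  have hdisj' : ∀ i j : ι, i ≠ j → Disjoint (Xs i) (Xs j) := by
    intro i j hij
    rcases lt_or_gt_of_ne (Subtype.coe_injective.ne hij) with h | h
    · exact hdisj _ _ h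
    · exact (hdisj _ _ h).symm
  refine ⟨?_, ι, Xs, hcard, fun i => hA i, fun i => i.2, hdisj', hall, hsmall, ?_⟩
  · choose p hp using fun i : ι => i.2
    rw [← hcard]
    refine mk_le_of_injective (f := p) fun i j hij => ?_
    by_contra hne
    exact Set.disjoint_left.1 (hdisj' i j hne) (hp i) (hij ▸ hp j)
  · intro Y hY
    obtain ⟨Z, hZ, hYZ⟩ := hF Y hY
    set a := e.symm ⟨Z, hZ⟩ with ha
    have hZa : (e a : Set X) = Z := by simp [ha]
    refine ⟨Subtype.val ⁻¹' Iic a, ?_, ?_⟩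
    · refine (mk_preimage_of_injective _ _ Subtype.val_injective).trans_lt ?_
      rw [← Iio_insert]
      refine (mk_insert_le).trans_lt ?_
      exact add_lt_of_lt hreg.aleph0_le (mk_Iio_ord_lt a)
        (one_lt_aleph0.trans_le hreg.aleph0_le)
    · intro x hx
      have := hcov a (hZa.symm ▸ hYZ hx)
      simp only [mem_iUnion, exists_prop] at this
      obtain ⟨b, hb, hxb⟩ := this
      simp only [mem_iUnion, exists_prop]
      exact ⟨⟨b, x, hxb⟩, hb, hxb⟩

/-- A partition nicely generating `I` has exactly `κ` pieces as soon as the underlying set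
carries a pairing with rows and columns in `I` such that every member of `I` has sections in
`I` along almost every column. -/
theorem mk_le_of_pairing (hI : ∀ A ∈ I, ∀ B ⊆ A, B ∈ I) (hreg : κ.IsRegular)
    (hι : κ ≤ #ι) (hmem : ∀ i, Xs i ∈ I) (hne : ∀ i, (Xs i).Nonempty)
    (hdisj : ∀ i j, i ≠ j → Disjoint (Xs i) (Xs j))
    (hsmall : ∀ Δ : Set ι, #Δ < κ → (⋃ i ∈ Δ, Xs i) ∈ I)
    (hcover : ∀ Y ∈ I, ∃ Δ : Set ι, #Δ < κ ∧ Y ⊆ ⋃ i ∈ Δ, Xs i)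
    (e : X → X → X) (hcol : ∀ x, range (fun y => e x y) ∈ I)
    (hrow : ∀ y, range (fun x => e x y) ∈ I)
    (hsec : ∀ A ∈ I, {x | {y | e x y ∈ A} ∉ I} ∈ I) : #ι ≤ κ := by
  by_contra! hlt
  have hκκ : κ * κ = κ := mul_eq_self hreg.aleph0_le
  obtain ⟨S, hS⟩ := le_mk_iff_exists_set.1 hι
  choose p hp using hne
  have hbound : ∀ {β : Type u} (T : Set β) (Δ : β → Set ι), #T ≤ κ → (∀ b, #(Δ b) < κ) →
      #(⋃ b ∈ T, Δ b : Set ι) ≤ κ := by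
    intro β T Δ hT hΔ
    refine (mk_biUnion_le _ _).trans ?_
    refine (mul_le_mul' hT (ciSup_le' fun b : T => (hΔ b).le)).trans hκκ.le
  choose R hR hRsub using fun y => hcover _ (hrow y)
  choose C hC hCsub using fun x => hcover _ (hcol x)
  choose B hB hBsub using fun i => hcover _ (hsec _ (hmem i))
  let D : Set ι := ⋃ y ∈ p '' S, R y
  have hD : #D ≤ κ := hbound _ _ (mk_image_le.trans hS.le) hR
  obtain ⟨i, hi⟩ : ∃ i, i ∉ ⋃ d ∈ D, B d := by
    by_contra! h
    have h1 := hbound D B hD hB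
    rw [eq_univ_of_forall h, mk_univ] at h1
    exact absurd h1 (not_le.2 hlt)
  have hgood : ∀ d ∈ D, {y | e (p i) y ∈ Xs d} ∈ I := by
    intro d hd
    by_contra hn
    have := hBsub d hn
    simp only [mem_iUnion, exists_prop] at this
    obtain ⟨j, hj, hij⟩ := this
    have : i = j := by
      by_contra hne
      exact Set.disjoint_left.1 (hdisj i j hne) (hp i) hij
    exact hi (mem_biUnion hd (this ▸ hj))
  have hT : p '' S ∈ I := by
    refine hI _ (biUnion_mem_of_pieces hI hreg hsmall hcover (C (p i) ∩ D)
      (fun d => {y | e (p i) y ∈ Xs d}) ((mk_le_mk_of_subset inter_subset_left).trans_lt (hC _))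
      fun d hd => hgood d hd.2) _ ?_
    intro y hy
    have h1 := hCsub (p i) ⟨y, rfl⟩
    have h2 := hRsub y ⟨p i, rfl⟩
    simp only [mem_iUnion, exists_prop] at h1 h2
    obtain ⟨c, hc, hyc⟩ := h1
    obtain ⟨r, hr, hyr⟩ := h2
    have hcr : c = r := by
      by_contra hne
      exact Set.disjoint_left.1 (hdisj c r hne) hyc hyr
    exact mem_biUnion ⟨hc, mem_biUnion hy (hcr ▸ hr)⟩ hyc
  obtain ⟨Δ, hΔ, hsub⟩ := hcover _ hT
  have := mk_le_mk_of_subset (subset_of_transversal_subset hdisj hp hsub)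
  rw [hS] at this
  exact absurd this (not_le.2 hΔ)

end Ideal

section CantorMeasure

/-- The set of sequences agreeing with `s` below `n`. -/
def cantorCylinder (n : ℕ) (s : ℕ → Bool) : Set (ℕ → Bool) := {f | ∀ i < n, f i = s i}

theorem measurableSet_cantorCylinder (n : ℕ) (s : ℕ → Bool) :
    MeasurableSet (cantorCylinder n s) := by
  have : cantorCylinder n s = ⋂ i, ⋂ (_ : i < n), (fun f : ℕ → Bool => f i) ⁻¹' {s i} := by
    ext f; simp [cantorCylinder]
  rw [this]
  exact MeasurableSet.iInter fun i => MeasurableSet.iInter fun _ =>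
    measurable_pi_apply i (measurableSet_singleton _)

/-- Cylinders of even length. -/
def evenCylinders : Set (Set (ℕ → Bool)) := {A | ∃ m s, cantorCylinder (2 * m) s = A}

theorem isPiSystem_evenCylinders : IsPiSystem evenCylinders := by
  have key : ∀ {m n : ℕ} {s t : ℕ → Bool}, m ≤ n →
      (cantorCylinder (2 * m) s ∩ cantorCylinder (2 * n) t).Nonempty →
      cantorCylinder (2 * m) s ∩ cantorCylinder (2 * n) t ∈ evenCylinders := by
    rintro m n s t hmn ⟨f, hf, hg⟩
    refine ⟨n, t, ?_⟩
    refine (inter_eq_right.2 fun g hgt i hi => ?_).symm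
    rw [hgt i (by omega), ← hg i (by omega), hf i hi]
  rintro _ ⟨m, s, rfl⟩ _ ⟨n, t, rfl⟩ hne
  rcases le_total m n with h | h
  · exact key h hne
  · rw [inter_comm] at hne ⊢
    exact key h hne

theorem generateFrom_evenCylinders :
    (MeasurableSpace.pi : MeasurableSpace (ℕ → Bool)) =
      MeasurableSpace.generateFrom evenCylinders := by
  apply le_antisymm
  · refine iSup_le fun i => ?_
    rw [← measurable_iff_comap_le]
    refine @measurable_to_bool _ (MeasurableSpace.generateFrom evenCylinders) _ ?_
    have : (fun f : ℕ → Bool => f i) ⁻¹' {true} =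
        ⋃ (l : Fin (2 * (i + 1)) → Bool), ⋃ (_ : l ⟨i, by omega⟩ = true),
          cantorCylinder (2 * (i + 1)) fun j => if h : j < 2 * (i + 1) then l ⟨j, h⟩ else true := by
      ext f
      simp only [mem_preimage, mem_singleton_iff, mem_iUnion, exists_prop, cantorCylinder,
        mem_ofPred_eq]
      constructor
      · intro h
        refine ⟨fun j => f j, h, fun j hj => by simp [hj]⟩
      · rintro ⟨l, hl, h⟩
        rw [h i (by omega), dif_pos (by omega), hl]
    rw [this]
    exact MeasurableSet.iUnion fun l => MeasurableSet.iUnion fun _ =>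
      MeasurableSpace.measurableSet_generateFrom ⟨_, _, rfl⟩
  · refine MeasurableSpace.generateFrom_le ?_
    rintro _ ⟨m, s, rfl⟩
    exact measurableSet_cantorCylinder _ _

/-- Interleave two binary sequences. -/
def interleave (x y : ℕ → Bool) : ℕ → Bool := fun n => if n % 2 = 0 then x (n / 2) else y (n / 2)

theorem interleave_even (x y : ℕ → Bool) (n : ℕ) : interleave x y (2 * n) = x n := by
  simp [interleave]

theorem interleave_odd (x y : ℕ → Bool) (n : ℕ) : interleave x y (2 * n + 1) = y n := by
  have h : (2 * n + 1) / 2 = n := by omega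
  simp [interleave, Nat.add_mod, h]

theorem measurable_interleave :
    Measurable fun q : (ℕ → Bool) × (ℕ → Bool) => interleave q.1 q.2 := by
  refine measurable_pi_lambda _ fun n => ?_
  by_cases h : n % 2 = 0
  · simp only [interleave, h, if_true]
    exact (measurable_pi_apply (n / 2)).comp measurable_fst
  · simp only [interleave, h, if_false]
    exact (measurable_pi_apply (n / 2)).comp measurable_snd

theorem interleave_preimage_cylinder (m : ℕ) (s : ℕ → Bool) :
    (fun q : (ℕ → Bool) × (ℕ → Bool) => interleave q.1 q.2) ⁻¹' cantorCylinder (2 * m) s =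
      cantorCylinder m (fun i => s (2 * i)) ×ˢ cantorCylinder m (fun i => s (2 * i + 1)) := by
  ext ⟨x, y⟩
  simp only [cantorCylinder, mem_preimage, mem_ofPred_eq, mem_prod]
  constructor
  · intro h
    exact ⟨fun i hi => by rw [← h _ (by omega), interleave_even],
      fun i hi => by rw [← h _ (by omega), interleave_odd]⟩
  · rintro ⟨hx, hy⟩ i hi
    obtain ⟨k, rfl | rfl⟩ := Nat.even_or_odd' i
    · rw [interleave_even, hx k (by omega)]
    · rw [interleave_odd, hy k (by omega)]

variable {μ : Measure (ℕ → Bool)}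

theorem IsCantorMeasure.isProbabilityMeasure (hμ : IsCantorMeasure μ) : IsProbabilityMeasure μ :=
  ⟨by simpa using hμ 0 fun _ => true⟩

theorem IsCantorMeasure.measurePreserving_interleave (hμ : IsCantorMeasure μ) :
    MeasurePreserving (fun q : (ℕ → Bool) × (ℕ → Bool) => interleave q.1 q.2) (μ.prod μ) μ := by
  have := hμ.isProbabilityMeasure
  refine ⟨measurable_interleave, ?_⟩
  have : IsProbabilityMeasure
      ((μ.prod μ).map fun q : (ℕ → Bool) × (ℕ → Bool) => interleave q.1 q.2) :=
    Measure.isProbabilityMeasure_map measurable_interleave.aemeasurable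
  refine ext_of_generate_finite _ generateFrom_evenCylinders isPiSystem_evenCylinders ?_ (by simp)
  rintro _ ⟨m, s, rfl⟩
  rw [Measure.map_apply measurable_interleave (measurableSet_cantorCylinder _ _),
    interleave_preimage_cylinder, Measure.prod_prod]
  simp only [cantorCylinder]
  rw [hμ, hμ, hμ, two_mul, pow_add]

theorem IsCantorMeasure.measure_singleton (hμ : IsCantorMeasure μ) (x : ℕ → Bool) :
    μ {x} = 0 := by
  refine le_antisymm ?_ zero_le
  refine ge_of_tendsto' (ENNReal.tendsto_pow_atTop_nhds_zero_of_lt_one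
    (r := 1 / 2) (by simp)) fun n => ?_
  rw [← hμ n x]
  exact measure_mono (by rintro _ rfl i -; rfl)

theorem IsCantorMeasure.measure_range_interleave_left (hμ : IsCantorMeasure μ) (x : ℕ → Bool) :
    μ (range fun y => interleave x y) = 0 := by
  have := hμ.isProbabilityMeasure
  let u : (ℕ → Bool) → (ℕ → Bool) := fun f n => f (2 * n)
  have hu : Measurable u := measurable_pi_lambda _ fun n => measurable_pi_apply _
  have hnull : μ (u ⁻¹' {x}) = 0 := by
    rw [← hμ.measurePreserving_interleave.measure_preimage
      (hu (measurableSet_singleton x)).nullMeasurableSet]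
    have : (fun q : (ℕ → Bool) × (ℕ → Bool) => interleave q.1 q.2) ⁻¹' (u ⁻¹' {x}) =
        {x} ×ˢ Set.univ := by
      ext ⟨a, b⟩
      simp [u, interleave_even, funext_iff]
    rw [this, Measure.prod_prod, hμ.measure_singleton, zero_mul]
  refine measure_mono_null ?_ hnull
  rintro _ ⟨y, rfl⟩
  exact funext fun n => interleave_even x y n

theorem IsCantorMeasure.measure_range_interleave_right (hμ : IsCantorMeasure μ) (y : ℕ → Bool) :
    μ (range fun x => interleave x y) = 0 := by
  have := hμ.isProbabilityMeasure
  let u : (ℕ → Bool) → (ℕ → Bool) := fun f n => f (2 * n + 1)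
  have hu : Measurable u := measurable_pi_lambda _ fun n => measurable_pi_apply _
  have hnull : μ (u ⁻¹' {y}) = 0 := by
    rw [← hμ.measurePreserving_interleave.measure_preimage
      (hu (measurableSet_singleton y)).nullMeasurableSet]
    have : (fun q : (ℕ → Bool) × (ℕ → Bool) => interleave q.1 q.2) ⁻¹' (u ⁻¹' {y}) =
        Set.univ ×ˢ {y} := by
      ext ⟨a, b⟩
      simp [u, interleave_odd, funext_iff]
    rw [this, Measure.prod_prod, hμ.measure_singleton, mul_zero]
  refine measure_mono_null ?_ hnull
  rintro _ ⟨x, rfl⟩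
  exact funext fun n => interleave_odd x y n

theorem IsCantorMeasure.measure_sections_interleave (hμ : IsCantorMeasure μ)
    {A : Set (ℕ → Bool)} (hA : μ A = 0) : μ {x | μ {y | interleave x y ∈ A} ≠ 0} = 0 := by
  have := hμ.isProbabilityMeasure
  have h := hμ.measurePreserving_interleave.quasiMeasurePreserving.preimage_null hA
  exact Measure.measure_ae_null_of_prod_null h

end CantorMeasure

/-- Corollary 6 (dual version): for a regular uncountable cardinal `κ`, the null ideal on
the Cantor space `2^ω` (with respect to the uniform product measure) is `(κ, λ)`-nicely
generated for some cardinal `λ` with `κ ≤ λ ≤ 2^ℵ₀` iff `add(N) = cof(N) = κ`. -/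
theorem null_nicelyGenerated_iff (μ : Measure (ℕ → Bool)) (hμ : IsCantorMeasure μ)
    (κ : Cardinal.{0}) (hreg : κ.IsRegular) (hunc : Cardinal.aleph 1 ≤ κ) :
    (∃ lam : Cardinal.{0}, κ ≤ lam ∧ lam ≤ 2 ^ Cardinal.aleph0 ∧
        NicelyGenerated {s : Set (ℕ → Bool) | μ s = 0} κ lam) ↔
      (addIdeal {s : Set (ℕ → Bool) | μ s = 0} = κ ∧
        cofIdeal {s : Set (ℕ → Bool) | μ s = 0} = κ) := by
  have hI : ∀ A ∈ {s : Set (ℕ → Bool) | μ s = 0}, ∀ B ⊆ A, B ∈ {s : Set (ℕ → Bool) | μ s = 0} :=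
    fun A hA B hBA => measure_mono_null hBA hA
  have huniv : Set.univ ∉ {s : Set (ℕ → Bool) | μ s = 0} := by
    have := hμ.isProbabilityMeasure
    simp
  have hsing : ∀ x, ∃ A ∈ {s : Set (ℕ → Bool) | μ s = 0}, x ∈ A :=
    fun x => ⟨{x}, hμ.measure_singleton x, rfl⟩
  constructor
  · rintro ⟨lam, hκ, -, ι, Xs, rfl, hmem, hne, hdisj, -, hsmall, hcover⟩
    have hadd := addIdeal_eq_of_pieces hI hreg hκ hmem hne hdisj hsmall hcover
    have hι := mk_le_of_pairing hI hreg hκ hmem hne hdisj hsmall hcover interleave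
      hμ.measure_range_interleave_left hμ.measure_range_interleave_right
      fun A hA => hμ.measure_sections_interleave hA
    refine ⟨hadd, le_antisymm ?_ ?_⟩
    · exact cofIdeal_le_of_pieces hreg (le_antisymm hι hκ) hsmall hcover
    · exact hadd.ge.trans (le_cofIdeal huniv hsing)
  · rintro ⟨hadd, hcof⟩
    obtain ⟨hle, hnice⟩ := exists_nicelyGenerated hI huniv hsing hadd hcof hreg
    exact ⟨κ, le_rfl, by simpa using hle, hnice⟩
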